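/- arXiv:2601.03853 — 2 statements merged into one kernel-verified Lean document; each statement's English description precedes it below -/
import Mathlib

section
/- Fix integers n ≥ 1 and K ≥ 1 and let B := {j/K : j = 0,1,…,K}. For each i = 1,…,n let μ_i be a Borel probability measure on [0,1] with continuous CDF F_i and quantile function φ_i(q) := inf{v ∈ [0,1] : F_i(v) ≥ q}, and let μ := μ_1 ⊗ … ⊗ μ_n on [0,1]^n. For each i let x_i : B^n → [0,1] be nondecreasing in its i-th argument (for every fixed b_{−i} ∈ B^{n−1}) and let p_i : B^n → [0,1] satisfy p_i(0, b_{−i}) = 0 for all b_{−i}. For each i let π^{(i)} be in the standard simplex Δ ⊂ ℝ^{K+1} with partial sums Π_j(π^{(i)}), and let s_i : [0,1] → B be the quantile bidding strategy of π^{(i)} with respect to μ_i (s_i(v) := 0 for v ≤ φ_i(Π_1(π^{(i)})), s_i(v) := (j−1)/K for v ∈ (φ_i(Π_{j−1}(π^{(i)})), φ_i(Π_j(π^{(i)}))], s_i(v) := 1 for v > φ_i(1)). For b_{−i} ∈ B^{n−1} define G_i(b_{−i}) ∈ ℝ^{K+1} by G_{i,k}(b_{−i}) := Σ_{j=k}^{K}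 (x_i((j−1)/K, b_{−i}) − x_i(j/K, b_{−i}))·φ_i(Π_j(π^{(i)})) + x_i(1, b_{−i}) − p_i((k−1)/K, b_{−i}). Define Rev := Σ_{i=1}^n ∫_{[0,1]^n} p_i(s_1(v_1),…,s_n(v_n)) dμ(v) and Rẽv := Σ_{i=1}^n ∫_{[0,1]^n} ( x̃_i(v_i; v_{−i})·v_i − ∫_0^{v_i} x̃_i(z; v_{−i}) dz ) dμ(v), where x̃_i(z; v_{−i}) := x_i(s_i(z), (s_j(v_j))_{j≠i}). Then, with e := (1,0,…,0) ∈ ℝ^{K+1}: Σ_{i=1}^n ∫_{[0,1]^{n−1}} G_i((s_j(v_j))_{j≠i})·(e − π^{(i)}) d(⊗_{j≠i} μ_j)(v_{−i}) = Rev − Rẽv. -/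
open MeasureTheory

/-- The finite bid set `B = {j/K : j = 0,…,K}`. -/
def BidSet (K : ℕ) : Set ℝ := {b | ∃ j ≤ K, b = (j : ℝ) / K}

/-- The box `[0,1]^n`. -/
def box (n : ℕ) : Set (Fin n → ℝ) := Set.univ.pi fun _ => Set.Icc (0 : ℝ) 1

/-- The CDF `F(v) = μ([0,v])` of a measure on `[0,1]`. -/
noncomputable def cdf (μ : Measure ℝ) (v : ℝ) : ℝ := (μ (Set.Icc 0 v)).toReal

/-- The quantile function `φ(q) = inf {v ∈ [0,1] : F(v) ≥ q}`. -/
noncomputable def quant (μ : Measure ℝ) (q : ℝ) : ℝ :=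
  sInf {v : ℝ | v ∈ Set.Icc (0 : ℝ) 1 ∧ q ≤ cdf μ v}

open scoped Classical in
/-- The quantile bidding strategy `s_π` of a quantile strategy `π` (indexed `π 0,…,π K`)
with respect to `μ`: since `quant μ` and the partial sums `Π_i = Σ_{ℓ<i} π ℓ` are
nondecreasing, counting the thresholds `φ(Π_i)` (`i = 1,…,K`) strictly below `v` gives
exactly the piecewise description `s_π v = 0` on `[0, φ(Π₁)]`, `s_π v = (j−1)/K` on
`(φ(Π_{j−1}), φ(Π_j)]` for `2 ≤ j ≤ K+1`, and `s_π v = 1` for `v > φ(1)`. -/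
noncomputable def sQ (K : ℕ) (μ : Measure ℝ) (π : ℕ → ℝ) (v : ℝ) : ℝ :=
  (((Finset.Icc 1 K).filter
      (fun i => quant μ (∑ ℓ ∈ Finset.range i, π ℓ) < v)).card : ℝ) / K

/-- The profile of bids `(s_1(v_1),…,s_n(v_n))` induced by the quantile strategies
`π i` and the value profile `v`. -/
noncomputable def bidProfile {n : ℕ} (K : ℕ) (μ : Fin n → Measure ℝ)
    (π : Fin n → ℕ → ℝ) (v : Fin n → ℝ) : Fin n → ℝ :=
  fun m => sQ K (μ m) (π m) (v m)

/-- The gradient `G_i(b₋ᵢ)` of bidder `i`'s quantile utility, with 0-based index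
`k ∈ {0,…,K}` (paper index `k+1`); the bids of the other bidders are read off from the
profile `b` (all occurrences of coordinate `i` are overridden, so `G` does not depend on
`b i`):
`G_{i,k}(b₋ᵢ) = Σ_{j=k+1}^{K} (x_i((j−1)/K, b₋ᵢ) − x_i(j/K, b₋ᵢ))·φ_i(Π_j(π i))
  + x_i(1, b₋ᵢ) − p_i(k/K, b₋ᵢ)`. -/
noncomputable def Gmulti {n : ℕ} (K : ℕ) (μ : Fin n → Measure ℝ)
    (x p : Fin n → (Fin n → ℝ) → ℝ) (π : Fin n → ℕ → ℝ)
    (i : Fin n) (b : Fin n → ℝ) (k : ℕ) : ℝ :=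
  (∑ j ∈ Finset.Icc (k + 1) K,
      (x i (Function.update b i (((j : ℝ) - 1) / K))
        - x i (Function.update b i ((j : ℝ) / K))) *
        quant (μ i) (∑ ℓ ∈ Finset.range j, π i ℓ))
    + x i (Function.update b i 1) - p i (Function.update b i ((k : ℝ) / K))

/-- Summation by parts against `e - π`. -/
lemma sum_mul_sub_eq_sum_sub_mul (Y π : ℕ → ℝ) (K : ℕ) :
    ∑ k ∈ Finset.range (K + 1), Y k * ((if k = 0 then (1 : ℝ) else 0) - π k)
      = ∑ j ∈ Finset.Icc 1 K, (Y (j - 1) - Y j) * (1 - ∑ ℓ ∈ Finset.range j, π ℓ)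
        + Y K * (1 - ∑ ℓ ∈ Finset.range (K + 1), π ℓ) := by
  induction K with
  | zero => simp
  | succ K ih =>
    rw [Finset.sum_range_succ, ih, Finset.sum_Icc_succ_top (by omega),
      Finset.sum_range_succ π (K + 1)]
    simp only [Nat.add_sub_cancel, Nat.succ_ne_zero, if_false]
    ring

open scoped Classical in
/-- Telescoping a sequence evaluated at the number of thresholds strictly below `v`. -/
lemma apply_card_filter_lt (φ Y : ℕ → ℝ) (v : ℝ) (K : ℕ)
    (hφ : ∀ i j, i ≤ j → j ≤ K → φ i ≤ φ j) :
    Y ((Finset.Icc 1 K).filter (fun i => φ i < v)).card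
      = Y 0 + ∑ j ∈ Finset.Icc 1 K, (Y j - Y (j - 1)) * (Set.Ioi (φ j)).indicator 1 v := by
  induction K with
  | zero => simp
  | succ K ih =>
    specialize ih fun i j hij hj => hφ i j hij (by omega)
    rw [Finset.sum_Icc_succ_top (by omega), ← add_assoc, ← ih,
      ← Finset.insert_Icc_right_eq_Icc_add_one (by omega), Finset.filter_insert]
    by_cases h : φ (K + 1) < v
    · have hall : (Finset.Icc 1 K).filter (fun i => φ i < v) = Finset.Icc 1 K := by
        refine Finset.filter_true_of_mem fun i hi => ?_
        rw [Finset.mem_Icc] at hi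
        exact (hφ i (K + 1) (by omega) le_rfl).trans_lt h
      rw [if_pos h, hall, Finset.card_insert_of_notMem (by simp)]
      simp [h]
    · simp [h]

lemma integral_indicator_Ioi {c v : ℝ} (hc : 0 ≤ c) (hv : 0 ≤ v) :
    ∫ z in (0 : ℝ)..v, (Set.Ioi c).indicator (1 : ℝ → ℝ) z
      = (v - c) * (Set.Ioi c).indicator 1 v := by
  rw [intervalIntegral.integral_of_le hv, integral_indicator_one measurableSet_Ioi,
    measureReal_restrict_apply measurableSet_Ioi, Set.inter_comm, Set.Ioc_inter_Ioi,
    sup_eq_right.2 hc, Real.volume_real_Ioc]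
  by_cases h : c < v
  · simp [h, h.le]
  · simp [h, not_lt.1 h]

lemma intervalIntegrable_indicator_Ioi (c a b : ℝ) :
    IntervalIntegrable ((Set.Ioi c).indicator (1 : ℝ → ℝ)) volume a b := by
  have h : IntervalIntegrable (fun _ : ℝ => (1 : ℝ)) volume a b := intervalIntegrable_const
  rw [intervalIntegrable_iff] at h ⊢
  exact h.indicator measurableSet_Ioi

section Quantile

variable {μ : Measure ℝ}

lemma cdf_mono [IsProbabilityMeasure μ] : Monotone (cdf μ) := fun _ _ h =>
  ENNReal.toReal_mono (measure_ne_top _ _) (measure_mono (Set.Icc_subset_Icc_right h))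

lemma quant_set_nonempty (hμ : μ (Set.Icc (0 : ℝ) 1) = 1) {q : ℝ} (hq : q ≤ 1) :
    {v : ℝ | v ∈ Set.Icc (0 : ℝ) 1 ∧ q ≤ cdf μ v}.Nonempty :=
  ⟨1, by simp, by simpa [cdf, hμ] using hq⟩

lemma quant_set_bddBelow (q : ℝ) : BddBelow {v : ℝ | v ∈ Set.Icc (0 : ℝ) 1 ∧ q ≤ cdf μ v} :=
  ⟨0, fun _ hv => hv.1.1⟩

lemma quant_nonneg (q : ℝ) : 0 ≤ quant μ q := Real.sInf_nonneg fun _ hv => hv.1.1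

lemma quant_le_quant (hμ : μ (Set.Icc (0 : ℝ) 1) = 1) {q r : ℝ} (hqr : q ≤ r) (hr : r ≤ 1) :
    quant μ q ≤ quant μ r :=
  csInf_le_csInf (quant_set_bddBelow q) (quant_set_nonempty hμ hr)
    fun _ hv => ⟨hv.1, hqr.trans hv.2⟩

lemma cdf_quant [IsProbabilityMeasure μ] (hμ : μ (Set.Icc (0 : ℝ) 1) = 1) (hF : ContinuousOn (cdf μ) (Set.Icc 0 1))
    (hF0 : cdf μ 0 = 0) {q : ℝ} (hq0 : 0 ≤ q) (hq1 : q ≤ 1) : cdf μ (quant μ q) = q := by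
  have hclosed : IsClosed {v : ℝ | v ∈ Set.Icc (0 : ℝ) 1 ∧ q ≤ cdf μ v} :=
    hF.preimage_isClosed_of_isClosed isClosed_Icc isClosed_Ici
  refine le_antisymm ?_
    (hclosed.csInf_mem (quant_set_nonempty hμ hq1) (quant_set_bddBelow q)).2
  obtain ⟨v, hv, hvq⟩ := intermediate_value_Icc zero_le_one hF
    (show q ∈ Set.Icc (cdf μ 0) (cdf μ 1) by rw [hF0]; exact ⟨hq0, by simpa [cdf, hμ] using hq1⟩)
  exact (cdf_mono (csInf_le (quant_set_bddBelow q) ⟨hv, hvq.ge⟩)).trans hvq.le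

lemma measureReal_Ioi_quant [IsProbabilityMeasure μ] (hμ : μ (Set.Icc (0 : ℝ) 1) = 1)
    (hF : ContinuousOn (cdf μ) (Set.Icc 0 1)) (hF0 : cdf μ 0 = 0) {q : ℝ} (hq0 : 0 ≤ q)
    (hq1 : q ≤ 1) : μ.real (Set.Ioi (quant μ q)) = 1 - q := by
  have hae : ∀ᵐ v ∂μ, v ∈ Set.Icc (0 : ℝ) 1 :=
    (prob_compl_eq_zero_iff measurableSet_Icc).2 hμ
  have heq : Set.Ioi (quant μ q) =ᵐ[μ] ((Set.Icc 0 (quant μ q))ᶜ : Set ℝ) := by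
    filter_upwards [hae] with v hv
    simp only [eq_iff_iff]
    change v ∈ Set.Ioi _ ↔ v ∈ (Set.Icc _ _)ᶜ
    simp [hv.1]
  rw [measureReal_congr heq, probReal_compl_eq_one_sub measurableSet_Icc]
  congr 1
  exact cdf_quant hμ hF hF0 hq0 hq1

end Quantile

/-- Resampling one coordinate preserves a finite product of probability measures. -/
lemma measurePreserving_update {n : ℕ} (μ : Fin n → Measure ℝ)
    [∀ i, IsProbabilityMeasure (μ i)] (i : Fin n) :
    MeasurePreserving (fun z : (Fin n → ℝ) × ℝ => Function.update z.1 i z.2)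
      ((Measure.pi μ).prod (μ i)) (Measure.pi μ) := by
  have hm : Measurable (fun z : (Fin n → ℝ) × ℝ => Function.update z.1 i z.2) := by
    fun_prop
  refine ⟨hm, (Measure.pi_eq fun s hs => ?_).symm⟩
  have hpre : (fun z : (Fin n → ℝ) × ℝ => Function.update z.1 i z.2) ⁻¹' Set.univ.pi s
      = (Set.univ.pi (Function.update s i Set.univ)) ×ˢ s i := by
    ext ⟨v, t⟩
    simp only [Set.mem_preimage, Set.mem_pi, Set.mem_univ, true_imp_iff, Set.mem_prod]
    constructor
    · intro h
      refine ⟨fun j => ?_, by simpa using h i⟩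
      by_cases hj : j = i
      · subst hj; simp
      · simpa [hj] using h j
    · rintro ⟨h, ht⟩ j
      by_cases hj : j = i
      · subst hj; simpa using ht
      · simpa [hj] using h j
  rw [Measure.map_apply hm (MeasurableSet.univ_pi hs), hpre, Measure.prod_prod, Measure.pi_pi,
    ← Finset.prod_erase_mul _ _ (Finset.mem_univ i),
    ← Finset.prod_erase_mul Finset.univ (fun j => μ j (s j)) (Finset.mem_univ i)]
  simp only [Function.update_self, measure_univ, mul_one]
  congr 1
  refine Finset.prod_congr rfl fun j hj => ?_
  rw [Function.update_of_ne (Finset.ne_of_mem_erase hj)]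

/-- A function not depending on coordinate `i` is independent of events in coordinate `i`. -/
lemma integral_mul_indicator_coord {n : ℕ} (μ : Fin n → Measure ℝ)
    [∀ i, IsProbabilityMeasure (μ i)] (i : Fin n) {H : (Fin n → ℝ) → ℝ} (hH : Measurable H)
    (hup : ∀ v t, H (Function.update v i t) = H v) {A : Set ℝ} (hA : MeasurableSet A) :
    ∫ v, H v * A.indicator 1 (v i) ∂(Measure.pi μ)
      = (∫ v, H v ∂(Measure.pi μ)) * (μ i).real A := by
  have hmp := measurePreserving_update μ i
  have hind : Measurable (A.indicator (1 : ℝ → ℝ)) := measurable_one.indicator hA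
  have hmeas : Measurable fun v : Fin n → ℝ => H v * A.indicator 1 (v i) :=
    hH.mul (hind.comp (measurable_pi_apply i))
  conv_lhs => rw [← hmp.map_eq]
  rw [integral_map hmp.measurable.aemeasurable hmeas.aestronglyMeasurable]
  simp only [hup, Function.update_self]
  rw [integral_prod_mul, integral_indicator_one hA]

section BidProfile

variable {n K : ℕ} {μ : Fin n → Measure ℝ} {π : Fin n → ℕ → ℝ}

open scoped Classical in
lemma card_filter_Icc_one_le (P : ℕ → Prop) : ((Finset.Icc 1 K).filter P).card ≤ K :=
  (Finset.card_filter_le _ _).trans (by simp)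

lemma bidProfile_mem (v : Fin n → ℝ) (j : Fin n) : bidProfile K μ π v j ∈ BidSet K :=
  ⟨_, card_filter_Icc_one_le _, rfl⟩

lemma update_bidProfile_mem (i : Fin n) (v : Fin n → ℝ) {k : ℕ} (hk : k ≤ K) (j : Fin n) :
    Function.update (bidProfile K μ π v) i ((k : ℝ) / K) j ∈ BidSet K := by
  by_cases h : j = i
  · subst h
    rw [Function.update_self]
    exact ⟨k, hk, rfl⟩
  · rw [Function.update_of_ne h]
    exact bidProfile_mem v j

/-- Any function of the bid profile is measurable, since only countably many bid profiles
occur. -/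
lemma measurable_comp_bidProfile (f : (Fin n → ℝ) → ℝ) :
    Measurable fun v => f (bidProfile K μ π v) := by
  classical
  have hN : Measurable fun (v : Fin n → ℝ) (m : Fin n) => ((Finset.Icc 1 K).filter
      (fun j => quant (μ m) (∑ ℓ ∈ Finset.range j, π m ℓ) < v m)).card := by
    refine measurable_pi_lambda _ fun m => ?_
    simp only [Finset.card_filter]
    refine Finset.measurable_sum _ fun j _ => ?_
    exact Measurable.ite (measurableSet_lt measurable_const (measurable_pi_apply m))
      measurable_const measurable_const
  have hf : Measurable fun N : Fin n → ℕ => f fun m => (N m : ℝ) / K := Measurable.of_discrete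
  convert hf.comp hN using 1
  ext v
  simp only [Function.comp_apply]
  congr 1

lemma update_bidProfile_update (i : Fin n) (v : Fin n → ℝ) (t c : ℝ) :
    Function.update (bidProfile K μ π (Function.update v i t)) i c
      = Function.update (bidProfile K μ π v) i c := by
  ext j
  by_cases h : j = i
  · subst h; simp
  · simp [h, bidProfile]

end BidProfile

lemma apply_sQ_eq (K : ℕ) (μ : Measure ℝ) (π : ℕ → ℝ)
    (hφ : ∀ i j, i ≤ j → j ≤ K → quant μ (∑ ℓ ∈ Finset.range i, π ℓ)
      ≤ quant μ (∑ ℓ ∈ Finset.range j, π ℓ)) (y : ℝ → ℝ) (v : ℝ) :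
    y (sQ K μ π v) = y (((0 : ℕ) : ℝ) / K) + ∑ j ∈ Finset.Icc 1 K,
      (y ((j : ℝ) / K) - y (((j - 1 : ℕ) : ℝ) / K)) *
        (Set.Ioi (quant μ (∑ ℓ ∈ Finset.range j, π ℓ))).indicator 1 v :=
  apply_card_filter_lt (fun j => quant μ (∑ ℓ ∈ Finset.range j, π ℓ))
    (fun j => y ((j : ℝ) / K)) v K hφ

/-- The Myerson payment of a step allocation rule is a sum over thresholds. -/
lemma myerson_payment_eq (K : ℕ) (μ : Measure ℝ) (π : ℕ → ℝ)
    (hφ : ∀ i j, i ≤ j → j ≤ K → quant μ (∑ ℓ ∈ Finset.range i, π ℓ)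
      ≤ quant μ (∑ ℓ ∈ Finset.range j, π ℓ)) (y : ℝ → ℝ) {v : ℝ} (hv : 0 ≤ v) :
    y (sQ K μ π v) * v - ∫ z in (0 : ℝ)..v, y (sQ K μ π z)
      = ∑ j ∈ Finset.Icc 1 K,
        (y ((j : ℝ) / K) - y (((j - 1 : ℕ) : ℝ) / K)) *
          quant μ (∑ ℓ ∈ Finset.range j, π ℓ) *
          (Set.Ioi (quant μ (∑ ℓ ∈ Finset.range j, π ℓ))).indicator 1 v := by
  simp only [apply_sQ_eq K μ π hφ y]
  have hint : ∀ j ∈ Finset.Icc 1 K, IntervalIntegrable (fun z =>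
      (y ((j : ℝ) / K) - y (((j - 1 : ℕ) : ℝ) / K)) *
        (Set.Ioi (quant μ (∑ ℓ ∈ Finset.range j, π ℓ))).indicator (1 : ℝ → ℝ) z)
      volume 0 v := fun j _ => (intervalIntegrable_indicator_Ioi _ _ _).const_mul _
  have hsum := IntervalIntegrable.sum (Finset.Icc 1 K) hint
  rw [intervalIntegral.integral_add (by simp) (by simpa [Finset.sum_fn] using hsum),
    intervalIntegral.integral_finsetSum hint]
  simp only [intervalIntegral.integral_const_mul, integral_indicator_Ioi (quant_nonneg _) hv,
    intervalIntegral.integral_const, smul_eq_mul, sub_zero]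
  rw [add_mul, Finset.sum_mul, mul_comm v, add_sub_add_left_eq_sub, ← Finset.sum_sub_distrib]
  exact Finset.sum_congr rfl fun j _ => by ring

lemma Gmulti_sub {n : ℕ} (K : ℕ) (μ : Fin n → Measure ℝ) (x p : Fin n → (Fin n → ℝ) → ℝ)
    (π : Fin n → ℕ → ℝ) (i : Fin n) (b : Fin n → ℝ) {j : ℕ} (hj : j ∈ Finset.Icc 1 K) :
    Gmulti K μ x p π i b (j - 1) - Gmulti K μ x p π i b j
      = (p i (Function.update b i ((j : ℝ) / K))
          - p i (Function.update b i (((j - 1 : ℕ) : ℝ) / K)))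
        - (x i (Function.update b i ((j : ℝ) / K))
          - x i (Function.update b i (((j - 1 : ℕ) : ℝ) / K))) *
          quant (μ i) (∑ ℓ ∈ Finset.range j, π i ℓ) := by
  rw [Finset.mem_Icc] at hj
  simp only [Gmulti]
  rw [Nat.sub_add_cancel hj.1, ← Finset.insert_Icc_add_one_left_eq_Icc hj.2,
    Finset.sum_insert (by simp), Nat.cast_sub hj.1, Nat.cast_one]
  ring

/-- **the main per-round lemma, multiple bidders.** Under allocation
monotonicity and voluntary participation, the sum over bidders of the expected inner
product of the quantile-utility gradient with `e − π i` (`e = (1,0,…,0)`) equals the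
auctioneer's expected revenue minus the expected revenue of the Myerson auxiliary
auction. (The integrand of the left side does not depend on the `i`-th coordinate, so
integrating it against the full product measure is the same as integrating over
`⊗_{j≠i} μ j`.) -/
theorem main_lemma_multi_bidder
    (n K : ℕ) (hn : 1 ≤ n) (hK : 1 ≤ K)
    (μ : Fin n → Measure ℝ) [∀ i, IsProbabilityMeasure (μ i)]
    (hμ : ∀ i, μ i (Set.Icc (0 : ℝ) 1) = 1)
    (hFcont : ∀ i, ContinuousOn (cdf (μ i)) (Set.Icc 0 1))
    (hF0 : ∀ i, cdf (μ i) 0 = 0)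
    (x p : Fin n → (Fin n → ℝ) → ℝ)
    (hx01 : ∀ i (b : Fin n → ℝ), (∀ j, b j ∈ BidSet K) → x i b ∈ Set.Icc (0 : ℝ) 1)
    (hxmono : ∀ i (b : Fin n → ℝ), (∀ j, b j ∈ BidSet K) →
      ∀ c ∈ BidSet K, ∀ c' ∈ BidSet K, c ≤ c' →
        x i (Function.update b i c) ≤ x i (Function.update b i c'))
    (hp01 : ∀ i (b : Fin n → ℝ), (∀ j, b j ∈ BidSet K) → p i b ∈ Set.Icc (0 : ℝ) 1)
    (hp0 : ∀ i (b : Fin n → ℝ), (∀ j, b j ∈ BidSet K) →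
      p i (Function.update b i 0) = 0)
    (π : Fin n → ℕ → ℝ)
    (hπ0 : ∀ i, ∀ k < K + 1, 0 ≤ π i k)
    (hπ1 : ∀ i, ∑ k ∈ Finset.range (K + 1), π i k = 1) :
    ∑ i, ∫ v in box n,
        (∑ k ∈ Finset.range (K + 1),
          Gmulti K μ x p π i (bidProfile K μ π v) k *
            ((if k = 0 then (1 : ℝ) else 0) - π i k)) ∂(Measure.pi μ)
      = (∑ i, ∫ v in box n, p i (bidProfile K μ π v) ∂(Measure.pi μ))
        - ∑ i, ∫ v in box n,
            (x i (bidProfile K μ π v) * v i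
              - ∫ z in (0 : ℝ)..(v i),
                  x i (Function.update (bidProfile K μ π v) i (sQ K (μ i) (π i) z)))
            ∂(Measure.pi μ) := by
  classical
  have hS0 : ∀ i, ∀ j ≤ K, 0 ≤ ∑ ℓ ∈ Finset.range j, π i ℓ := fun i j hj =>
    Finset.sum_nonneg fun ℓ hℓ => hπ0 i ℓ (by rw [Finset.mem_range] at hℓ; omega)
  have hSmono : ∀ i j k, j ≤ k → k ≤ K + 1 →
      ∑ ℓ ∈ Finset.range j, π i ℓ ≤ ∑ ℓ ∈ Finset.range k, π i ℓ := fun i j k hjk hk =>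
    Finset.sum_le_sum_of_subset_of_nonneg (Finset.range_mono hjk) fun ℓ hℓ _ =>
      hπ0 i ℓ (by rw [Finset.mem_range] at hℓ; omega)
  have hS1 : ∀ i, ∀ j ≤ K, ∑ ℓ ∈ Finset.range j, π i ℓ ≤ 1 := fun i j hj =>
    (hSmono i j (K + 1) (by omega) le_rfl).trans (hπ1 i).le
  have hφ : ∀ i j k, j ≤ k → k ≤ K → quant (μ i) (∑ ℓ ∈ Finset.range j, π i ℓ)
      ≤ quant (μ i) (∑ ℓ ∈ Finset.range k, π i ℓ) := fun i j k hjk hk =>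
    quant_le_quant (hμ i) (hSmono i j k hjk (by omega)) (hS1 i k hk)
  have hbox : ∀ᵐ v ∂(Measure.pi μ), v ∈ box n := by
    have hcoord : ∀ i, ∀ᵐ t ∂(μ i), t ∈ Set.Icc (0 : ℝ) 1 := fun i =>
      (prob_compl_eq_zero_iff measurableSet_Icc).2 (hμ i)
    have hall : ∀ᵐ v ∂(Measure.pi μ), ∀ i, v i ∈ Set.Icc (0 : ℝ) 1 :=
      ae_all_iff.2 fun i => (Measure.quasiMeasurePreserving_eval μ i).ae (hcoord i)
    filter_upwards [hall] with v hv i _ using hv i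
  rw [Measure.restrict_eq_self_of_ae_mem hbox, ← Finset.sum_sub_distrib]
  refine Finset.sum_congr rfl fun i _ => ?_
  let D : ((Fin n → ℝ) → ℝ) → ℕ → (Fin n → ℝ) → ℝ := fun y j v =>
    y (Function.update (bidProfile K μ π v) i ((j : ℝ) / K))
      - y (Function.update (bidProfile K μ π v) i (((j - 1 : ℕ) : ℝ) / K))
  let φ : ℕ → ℝ := fun j => quant (μ i) (∑ ℓ ∈ Finset.range j, π i ℓ)
  have hDmeas : ∀ y j, Measurable (D y j) := fun y j =>
    measurable_comp_bidProfile fun b => y (Function.update b i ((j : ℝ) / K))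
      - y (Function.update b i (((j - 1 : ℕ) : ℝ) / K))
  have hDup : ∀ y j v t, D y j (Function.update v i t) = D y j v := fun y j v t => by
    simp only [D, update_bidProfile_update]
  have hDint : ∀ y : (Fin n → ℝ) → ℝ, (∀ b, (∀ j, b j ∈ BidSet K) → y b ∈ Set.Icc (0 : ℝ) 1) →
      ∀ j ∈ Finset.Icc 1 K, Integrable (D y j) (Measure.pi μ) := by
    intro y hy j hj
    rw [Finset.mem_Icc] at hj
    refine Integrable.of_bound (hDmeas y j).aestronglyMeasurable 1 (.of_forall fun v => ?_)
    have h1 := hy _ (update_bidProfile_mem (μ := μ) (π := π) i v hj.2)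
    have h2 := hy _ (update_bidProfile_mem (μ := μ) (π := π) i v (k := j - 1) (by omega))
    rw [Real.norm_eq_abs, abs_le]
    constructor <;> simp only [D] <;> linarith [h1.1, h1.2, h2.1, h2.2]
  have hself : ∀ v, bidProfile K μ π v
      = Function.update (bidProfile K μ π v) i (sQ K (μ i) (π i) (v i)) := fun v =>
    (Function.update_eq_self i (bidProfile K μ π v)).symm
  have hpay : ∀ v, p i (bidProfile K μ π v)
      = ∑ j ∈ Finset.Icc 1 K, D (p i) j v * (Set.Ioi (φ j)).indicator 1 (v i) := by
    intro v
    conv_lhs => rw [hself v]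
    rw [apply_sQ_eq K (μ i) (π i) (hφ i)
      (fun c => p i (Function.update (bidProfile K μ π v) i c)) (v i), Nat.cast_zero, zero_div,
      hp0 i _ (bidProfile_mem v), zero_add]
  have hmye : ∀ᵐ v ∂(Measure.pi μ), x i (bidProfile K μ π v) * v i
      - ∫ z in (0 : ℝ)..(v i), x i (Function.update (bidProfile K μ π v) i (sQ K (μ i) (π i) z))
      = ∑ j ∈ Finset.Icc 1 K, D (x i) j v * φ j * (Set.Ioi (φ j)).indicator 1 (v i) := by
    filter_upwards [hbox] with v hv
    rw [← myerson_payment_eq K (μ i) (π i) (hφ i)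
      (fun c => x i (Function.update (bidProfile K μ π v) i c)) (hv i trivial).1, ← hself v]
  have hgrad : ∀ v, ∑ k ∈ Finset.range (K + 1), Gmulti K μ x p π i (bidProfile K μ π v) k *
      ((if k = 0 then (1 : ℝ) else 0) - π i k)
      = ∑ j ∈ Finset.Icc 1 K, (D (p i) j v - D (x i) j v * φ j) *
        (1 - ∑ ℓ ∈ Finset.range j, π i ℓ) := by
    intro v
    rw [sum_mul_sub_eq_sum_sub_mul, hπ1 i, sub_self, mul_zero, add_zero]
    exact Finset.sum_congr rfl fun j hj => by rw [Gmulti_sub K μ x p π i _ hj]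
  have hindint : ∀ (H : (Fin n → ℝ) → ℝ) (c : ℝ), Integrable H (Measure.pi μ) →
      Integrable (fun v => H v * (Set.Ioi c).indicator 1 (v i)) (Measure.pi μ) := by
    intro H c hH
    have hA : MeasurableSet ((fun v : Fin n → ℝ => v i) ⁻¹' Set.Ioi c) :=
      measurable_pi_apply i measurableSet_Ioi
    refine (hH.indicator hA).congr (.of_forall fun v => ?_)
    by_cases h : c < v i <;> simp [h]
  have hDp := hDint (p i) (hp01 i)
  have hDx := fun j hj => (hDint (x i) (hx01 i) j hj).mul_const (φ j)
  rw [integral_congr_ae hmye]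
  simp only [hpay, hgrad]
  have hDsub : ∀ j ∈ Finset.Icc 1 K, Integrable (fun v =>
      (D (p i) j v - D (x i) j v * φ j) * (1 - ∑ ℓ ∈ Finset.range j, π i ℓ)) (Measure.pi μ) :=
    fun j hj => ((hDp j hj).sub (hDx j hj)).mul_const _
  rw [integral_finsetSum _ hDsub,
    integral_finsetSum _ fun j hj => hindint _ _ (hDp j hj),
    integral_finsetSum _ fun j hj => hindint _ _ (hDx j hj), ← Finset.sum_sub_distrib]
  refine Finset.sum_congr rfl fun j hj => ?_
  have hjK := (Finset.mem_Icc.1 hj).2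
  rw [integral_mul_indicator_coord μ i (hDmeas (p i) j) (hDup (p i) j) measurableSet_Ioi,
    integral_mul_indicator_coord μ i ((hDmeas (x i) j).mul_const (φ j))
      (fun v t => by rw [hDup]) measurableSet_Ioi,
    measureReal_Ioi_quant (hμ i) (hFcont i) (hF0 i) (hS0 i j hjK) (hS1 i j hjK),
    integral_mul_const, integral_sub (hDp j hj) (hDx j hj), sub_mul]
end

section
/- Fix integers K ≥ 1 and T ≥ 1 and let B := {j/K : j = 0,1,…,K}. Let μ be a Borel probability measure on [0,1] with continuous CDF F(v) := μ([0,v]) and quantile function φ(q) := inf{v ∈ [0,1] : F(v) ≥ q}. For t = 1,…,T let X_t : B → [0,1] be nondecreasing and P_t : B → [0,1] arbitrary; write x_{t,j} := X_t((j−1)/K), p_{t,k} := P_t((k−1)/K), and u_t(s) := ∫_{[0,1]} (X_t(s(v))·v − P_t(s(v))) dμ(v) for Borel-measurable s : [0,1] → B. For t = 1,…,T let π^{(t)} be in the standard simplex Δ ⊂ ℝ^{K+1} with partial sums Π_j(π^{(t)}), let s_{π^{(t)}} : [0,1] → B be the quantile bidding strategy of π^{(t)} (s_{π^{(t)}}(v)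 := 0 for v ≤ φ(Π_1(π^{(t)})), s_{π^{(t)}}(v) := (j−1)/K for v ∈ (φ(Π_{j−1}(π^{(t)})), φ(Π_j(π^{(t)}))], s_{π^{(t)}}(v) := 1 for v > φ(1)), and define G_t(π^{(t)}) ∈ ℝ^{K+1} by G_{t,k}(π^{(t)}) := Σ_{j=k}^{K} (x_{t,j} − x_{t,j+1})·φ(Π_j(π^{(t)})) + x_{t,K+1} − p_{t,k}. Suppose R ∈ ℝ satisfies Σ_{t=1}^{T} G_t(π^{(t)})·(π − π^{(t)}) ≤ R for every π ∈ Δ. Then for every Borel-measurable strategy s : [0,1] → B, Σ_{t=1}^{T} ( u_t(s) − u_t(s_{π^{(t)}}) ) ≤ R. -/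
open MeasureTheory

/-- The bidder's expected utility `u(s) = ∫_{[0,1]} (X(s v) * v - P(s v)) dμ(v)`. -/
noncomputable def util (μ : Measure ℝ) (X P : ℝ → ℝ) (s : ℝ → ℝ) : ℝ :=
  ∫ v in Set.Icc (0 : ℝ) 1, (X (s v) * v - P (s v)) ∂μ

/-- The gradient of the quantile utility function at round `t`, with 0-based index
`k ∈ {0,…,K}` (paper index `k+1`):
`G_{t,k}(π) = Σ_{j=k+1}^{K} (X_t((j−1)/K) − X_t(j/K))·φ(Π_j) + X_t(K/K) − P_t(k/K)`. -/
noncomputable def Gq (K : ℕ) (μ : Measure ℝ) (X P : ℝ → ℝ) (π : ℕ → ℝ) (k : ℕ) : ℝ :=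
  (∑ j ∈ Finset.Icc (k + 1) K,
      (X (((j : ℝ) - 1) / K) - X ((j : ℝ) / K)) *
        quant μ (∑ ℓ ∈ Finset.range j, π ℓ))
    + X ((K : ℝ) / K) - P ((k : ℝ) / K)

lemma cdf_le_cdf (μ : Measure ℝ) [IsFiniteMeasure μ] {a b : ℝ} (h : a ≤ b) :
    cdf μ a ≤ cdf μ b :=
  measureReal_mono (Set.Icc_subset_Icc_right h)

lemma bddBelow_quant_set (μ : Measure ℝ) (q : ℝ) :
    BddBelow {v : ℝ | v ∈ Set.Icc (0 : ℝ) 1 ∧ q ≤ cdf μ v} :=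
  ⟨0, fun _ hv => hv.1.1⟩

lemma one_le_cdf_one {μ : Measure ℝ} (hμ : μ (Set.Icc (0 : ℝ) 1) = 1) : 1 ≤ cdf μ 1 := by
  simp [cdf, hμ]

lemma quant_mono {μ : Measure ℝ} (hμ : μ (Set.Icc (0 : ℝ) 1) = 1) {q r : ℝ}
    (hqr : q ≤ r) (hr : r ≤ 1) : quant μ q ≤ quant μ r :=
  csInf_le_csInf (bddBelow_quant_set μ q)
    ⟨1, ⟨zero_le_one, le_rfl⟩, hr.trans (one_le_cdf_one hμ)⟩
    fun _ hv => ⟨hv.1, hqr.trans hv.2⟩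

/-- A continuous CDF is a left inverse of its quantile function. -/
lemma quant_mem_and_cdf_quant {μ : Measure ℝ} [IsFiniteMeasure μ]
    (hμ : μ (Set.Icc (0 : ℝ) 1) = 1)
    (hFcont : ContinuousOn (cdf μ) (Set.Icc 0 1)) (hF0 : cdf μ 0 = 0)
    {q : ℝ} (hq : q ∈ Set.Icc (0 : ℝ) 1) :
    quant μ q ∈ Set.Icc (0 : ℝ) 1 ∧ cdf μ (quant μ q) = q := by
  have hclosed : IsClosed {v : ℝ | v ∈ Set.Icc (0 : ℝ) 1 ∧ q ≤ cdf μ v} :=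
    hFcont.preimage_isClosed_of_isClosed isClosed_Icc isClosed_Ici
  have hmem : quant μ q ∈ {v : ℝ | v ∈ Set.Icc (0 : ℝ) 1 ∧ q ≤ cdf μ v} :=
    hclosed.csInf_mem
      ⟨1, ⟨zero_le_one, le_rfl⟩, hq.2.trans (one_le_cdf_one hμ)⟩ (bddBelow_quant_set μ q)
  obtain ⟨v, hv, hvq⟩ := intermediate_value_Icc zero_le_one hFcont
    (show q ∈ Set.Icc (cdf μ 0) (cdf μ 1) from
      ⟨hF0.trans_le hq.1, hq.2.trans (one_le_cdf_one hμ)⟩)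
  have hle : quant μ q ≤ v := csInf_le (bddBelow_quant_set μ q) ⟨hv, hvq.ge⟩
  exact ⟨hmem.1, le_antisymm ((cdf_le_cdf μ hle).trans_eq hvq) hmem.2⟩

lemma measureReal_Ioi_quant_inter_Icc {μ : Measure ℝ} [IsFiniteMeasure μ]
    (hμ : μ (Set.Icc (0 : ℝ) 1) = 1)
    (hFcont : ContinuousOn (cdf μ) (Set.Icc 0 1)) (hF0 : cdf μ 0 = 0)
    {q : ℝ} (hq : q ∈ Set.Icc (0 : ℝ) 1) :
    μ.real (Set.Ioi (quant μ q) ∩ Set.Icc 0 1) = 1 - q := by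
  obtain ⟨hmem, hcdf⟩ := quant_mem_and_cdf_quant hμ hFcont hF0 hq
  have hset : Set.Ioi (quant μ q) ∩ Set.Icc 0 1 = Set.Icc 0 1 \ Set.Icc 0 (quant μ q) := by
    ext v
    simp only [Set.mem_inter_iff, Set.mem_Ioi, Set.mem_Icc, Set.mem_sdiff]
    constructor
    · rintro ⟨h1, h2⟩
      exact ⟨h2, fun h => absurd h.2 (not_le.2 h1)⟩
    · rintro ⟨h1, h2⟩
      exact ⟨not_le.1 fun h => h2 ⟨h1.1, h⟩, h1⟩
  have hcdf' : μ.real (Set.Icc 0 (quant μ q)) = q := hcdf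
  have hone : μ.real (Set.Icc 0 1) = 1 := by simp [Measure.real, hμ]
  rw [hset, measureReal_sdiff (Set.Icc_subset_Icc_right hmem.2) measurableSet_Icc, hcdf', hone]

lemma abs_apply_le_sum_abs {K : ℕ} (a : ℕ → ℝ) {k : ℕ} (hk : k ≤ K) :
    |a k| ≤ ∑ i ∈ Finset.range (K + 1), |a i| :=
  Finset.single_le_sum (f := fun i => |a i|) (fun _ _ => abs_nonneg _)
    (Finset.mem_range.2 (Nat.lt_succ_of_le hk))

lemma integrableOn_affine_comp_index (μ : Measure ℝ) [IsFiniteMeasure μ] {K : ℕ} {m : ℝ → ℕ}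
    (hm : Measurable m) (hmK : ∀ v ∈ Set.Icc (0 : ℝ) 1, m v ≤ K) (a b : ℕ → ℝ) :
    IntegrableOn (fun v => a (m v) * v + b (m v)) (Set.Icc 0 1) μ := by
  have hmeas : Measurable fun v => a (m v) * v + b (m v) :=
    ((measurable_from_nat.comp hm).mul measurable_id).add (measurable_from_nat.comp hm)
  refine IntegrableOn.of_bound (measure_lt_top μ _) hmeas.aestronglyMeasurable
    (∑ i ∈ Finset.range (K + 1), |a i| + ∑ i ∈ Finset.range (K + 1), |b i|) ?_
  filter_upwards [ae_restrict_mem measurableSet_Icc] with v hv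
  have h1 : |a (m v) * v| ≤ |a (m v)| := by
    rw [abs_mul, abs_of_nonneg hv.1]
    exact mul_le_of_le_one_right (abs_nonneg _) hv.2
  exact (abs_add_le _ _).trans (add_le_add
    (h1.trans (abs_apply_le_sum_abs a (hmK v hv))) (abs_apply_le_sum_abs b (hmK v hv)))

lemma setIntegral_comp_index (μ : Measure ℝ) [IsFiniteMeasure μ] {K : ℕ} {m : ℝ → ℕ}
    (hm : Measurable m) (hmK : ∀ v ∈ Set.Icc (0 : ℝ) 1, m v ≤ K) (g : ℕ → ℝ) :
    ∫ v in Set.Icc (0 : ℝ) 1, g (m v) ∂μ =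
      ∑ k ∈ Finset.range (K + 1), g k * μ.real (m ⁻¹' {k} ∩ Set.Icc 0 1) := by
  have hms : ∀ k, MeasurableSet (m ⁻¹' {k}) := fun k => hm (measurableSet_singleton k)
  calc
    _ = ∫ v in Set.Icc (0 : ℝ) 1, ∑ k ∈ Finset.range (K + 1),
          (m ⁻¹' {k}).indicator (fun _ => g k) v ∂μ := by
      refine setIntegral_congr_fun measurableSet_Icc fun v hv => ?_
      have hmem : m v ∈ Finset.range (K + 1) := Finset.mem_range.2 (Nat.lt_succ_of_le (hmK v hv))
      classical
      change g (m v) = ∑ k ∈ Finset.range (K + 1), (m ⁻¹' {k}).indicator (fun _ => g k) v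
      simp only [Set.indicator_apply, Set.mem_preimage, Set.mem_singleton_iff]
      rw [Finset.sum_ite_eq, if_pos hmem]
    _ = _ := by
      rw [integral_finsetSum _ fun k _ => (integrable_const (g k)).indicator (hms k)]
      refine Finset.sum_congr rfl fun k _ => ?_
      rw [integral_indicator_const _ (hms k), measureReal_restrict_apply (hms k), smul_eq_mul,
        mul_comm]

open scoped Classical in
/-- The number of thresholds `φ(Π_i)`, `1 ≤ i ≤ K`, strictly below `v`. -/
noncomputable def bidIndex (K : ℕ) (μ : Measure ℝ) (π : ℕ → ℝ) (v : ℝ) : ℕ :=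
  ((Finset.Icc 1 K).filter
    (fun i => quant μ (∑ ℓ ∈ Finset.range i, π ℓ) < v)).card

lemma bidIndex_le (K : ℕ) (μ : Measure ℝ) (π : ℕ → ℝ) (v : ℝ) : bidIndex K μ π v ≤ K :=
  (Finset.card_filter_le _ _).trans_eq (by simp)

lemma measurable_bidIndex (K : ℕ) (μ : Measure ℝ) (π : ℕ → ℝ) : Measurable (bidIndex K μ π) :=
  Monotone.measurable fun _ _ hvw =>
    Finset.card_le_card (Finset.monotone_filter_right _ fun _ _ h => lt_of_lt_of_le h hvw)

section Simplex

variable {K : ℕ} {π : ℕ → ℝ}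

lemma partialSum_mono (hπ0 : ∀ k < K + 1, 0 ≤ π k) {i j : ℕ} (hij : i ≤ j) (hj : j ≤ K + 1) :
    ∑ ℓ ∈ Finset.range i, π ℓ ≤ ∑ ℓ ∈ Finset.range j, π ℓ :=
  Finset.sum_le_sum_of_subset_of_nonneg (Finset.range_mono hij)
    fun ℓ hℓ _ => hπ0 ℓ ((Finset.mem_range.1 hℓ).trans_le hj)

lemma partialSum_mem_Icc (hπ0 : ∀ k < K + 1, 0 ≤ π k)
    (hπ1 : ∑ k ∈ Finset.range (K + 1), π k = 1) {j : ℕ} (hj : j ≤ K + 1) :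
    ∑ ℓ ∈ Finset.range j, π ℓ ∈ Set.Icc (0 : ℝ) 1 :=
  ⟨by simpa using partialSum_mono hπ0 (Nat.zero_le j) hj,
    hπ1 ▸ partialSum_mono hπ0 hj le_rfl⟩

lemma le_bidIndex_iff {μ : Measure ℝ} (hμ : μ (Set.Icc (0 : ℝ) 1) = 1)
    (hπ0 : ∀ k < K + 1, 0 ≤ π k) (hπ1 : ∑ k ∈ Finset.range (K + 1), π k = 1)
    {j : ℕ} (hj1 : 1 ≤ j) (hjK : j ≤ K) (v : ℝ) :
    j ≤ bidIndex K μ π v ↔ quant μ (∑ ℓ ∈ Finset.range j, π ℓ) < v := by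
  have hmono : ∀ i i', i ≤ i' → i' ≤ K →
      quant μ (∑ ℓ ∈ Finset.range i, π ℓ) ≤ quant μ (∑ ℓ ∈ Finset.range i', π ℓ) :=
    fun i i' h h' => quant_mono hμ (partialSum_mono hπ0 h (h'.trans K.le_succ))
      (partialSum_mem_Icc hπ0 hπ1 (h'.trans K.le_succ)).2
  constructor
  · intro h
    by_contra hv
    have hsub : (Finset.Icc 1 K).filter
        (fun i => quant μ (∑ ℓ ∈ Finset.range i, π ℓ) < v) ⊆ Finset.Icc 1 (j - 1) := by
      intro i hi
      rw [Finset.mem_filter, Finset.mem_Icc] at hi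
      have : i < j := by
        by_contra hij
        exact hv ((hmono j i (not_lt.1 hij) hi.1.2).trans_lt hi.2)
      rw [Finset.mem_Icc]
      omega
    have hcard : bidIndex K μ π v ≤ j - 1 :=
      (Finset.card_le_card hsub).trans_eq (by simp)
    omega
  · intro h
    have hsub : Finset.Icc 1 j ⊆ (Finset.Icc 1 K).filter
        (fun i => quant μ (∑ ℓ ∈ Finset.range i, π ℓ) < v) := by
      intro i hi
      rw [Finset.mem_Icc] at hi
      rw [Finset.mem_filter, Finset.mem_Icc]
      exact ⟨⟨hi.1, hi.2.trans hjK⟩, (hmono i j hi.2 hjK).trans_lt h⟩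
    exact (by simp : j = (Finset.Icc 1 j).card).trans_le (Finset.card_le_card hsub)

lemma measureReal_le_bidIndex {μ : Measure ℝ} [IsFiniteMeasure μ]
    (hμ : μ (Set.Icc (0 : ℝ) 1) = 1)
    (hFcont : ContinuousOn (cdf μ) (Set.Icc 0 1)) (hF0 : cdf μ 0 = 0)
    (hπ0 : ∀ k < K + 1, 0 ≤ π k) (hπ1 : ∑ k ∈ Finset.range (K + 1), π k = 1)
    {j : ℕ} (hj : j ≤ K + 1) :
    μ.real (bidIndex K μ π ⁻¹' Set.Ici j ∩ Set.Icc 0 1) = 1 - ∑ ℓ ∈ Finset.range j, π ℓ := by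
  rcases Nat.eq_zero_or_pos j with rfl | hj1
  · simp [Measure.real, hμ]
  rcases hj.eq_or_lt with rfl | hjK
  · have : bidIndex K μ π ⁻¹' Set.Ici (K + 1) = ∅ := by
      ext v
      simpa using Nat.lt_succ_of_le (bidIndex_le K μ π v)
    simp [this, hπ1]
  · have : bidIndex K μ π ⁻¹' Set.Ici j =
        Set.Ioi (quant μ (∑ ℓ ∈ Finset.range j, π ℓ)) := by
      ext v
      exact le_bidIndex_iff hμ hπ0 hπ1 hj1 (Nat.lt_succ_iff.1 hjK) v
    rw [this, measureReal_Ioi_quant_inter_Icc hμ hFcont hF0 (partialSum_mem_Icc hπ0 hπ1 hj)]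

/-- The quantile bidding strategy of `π` plays the `k`-th bid with probability `π k`. -/
lemma measureReal_bidIndex_eq {μ : Measure ℝ} [IsFiniteMeasure μ]
    (hμ : μ (Set.Icc (0 : ℝ) 1) = 1)
    (hFcont : ContinuousOn (cdf μ) (Set.Icc 0 1)) (hF0 : cdf μ 0 = 0)
    (hπ0 : ∀ k < K + 1, 0 ≤ π k) (hπ1 : ∑ k ∈ Finset.range (K + 1), π k = 1)
    {k : ℕ} (hk : k < K + 1) :
    μ.real (bidIndex K μ π ⁻¹' {k} ∩ Set.Icc 0 1) = π k := by
  have hset : bidIndex K μ π ⁻¹' {k} ∩ Set.Icc 0 1 =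
      (bidIndex K μ π ⁻¹' Set.Ici k ∩ Set.Icc 0 1) \
        (bidIndex K μ π ⁻¹' Set.Ici (k + 1) ∩ Set.Icc 0 1) := by
    ext v
    simp only [Set.mem_inter_iff, Set.mem_preimage, Set.mem_singleton_iff, Set.mem_sdiff,
      Set.mem_Ici]
    constructor
    · rintro ⟨h1, h2⟩
      exact ⟨⟨h1.ge, h2⟩, fun h => by omega⟩
    · rintro ⟨⟨h1, h2⟩, h3⟩
      exact ⟨by by_contra h; exact h3 ⟨by omega, h2⟩, h2⟩
  have hsub : bidIndex K μ π ⁻¹' Set.Ici (k + 1) ∩ Set.Icc 0 1 ⊆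
      bidIndex K μ π ⁻¹' Set.Ici k ∩ Set.Icc 0 1 :=
    Set.inter_subset_inter_left _ (Set.preimage_mono (Set.Ici_subset_Ici.2 k.le_succ))
  rw [hset, measureReal_sdiff hsub
      ((measurable_bidIndex K μ π measurableSet_Ici).inter measurableSet_Icc),
    measureReal_le_bidIndex hμ hFcont hF0 hπ0 hπ1 hk.le,
    measureReal_le_bidIndex hμ hFcont hF0 hπ0 hπ1 hk, Finset.sum_range_succ]
  ring

end Simplex

lemma apply_le_of_unimodal {D : ℕ → ℝ} {K n : ℕ} (hup : ∀ i < n, D i ≤ D (i + 1))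
    (hdown : ∀ i, n ≤ i → i < K → D (i + 1) ≤ D i) {k : ℕ} (hk : k ≤ K) : D k ≤ D n := by
  rcases le_total k n with h | h
  · have : ∀ m, k ≤ m → m ≤ n → D k ≤ D m := by
      intro m hm
      induction m, hm using Nat.le_induction with
      | base => exact fun _ => le_rfl
      | succ i _ ih => exact fun hi => (ih (Nat.le_of_lt hi)).trans (hup i hi)
    exact this n h le_rfl
  · have : ∀ m, n ≤ m → m ≤ K → D m ≤ D n := by
      intro m hm
      induction m, hm using Nat.le_induction with
      | base => exact fun _ => le_rfl
      | succ i hi ih => exact fun hiK => (hdown i hi hiK).trans (ih (Nat.le_of_lt hiK))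
    exact this k h hk

lemma Gq_succ_sub_Gq (K : ℕ) (μ : Measure ℝ) (X P : ℝ → ℝ) (π : ℕ → ℝ) {i : ℕ} (hi : i < K) :
    Gq K μ X P π (i + 1) - Gq K μ X P π i =
      (X (((i + 1 : ℕ) : ℝ) / K) - X ((i : ℝ) / K)) *
          quant μ (∑ ℓ ∈ Finset.range (i + 1), π ℓ)
        - P (((i + 1 : ℕ) : ℝ) / K) + P ((i : ℝ) / K) := by
  have hins : Finset.Icc (i + 1) K = insert (i + 1) (Finset.Icc (i + 1 + 1) K) := by
    ext x
    simp only [Finset.mem_Icc, Finset.mem_insert]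
    omega
  unfold Gq
  rw [hins, Finset.sum_insert (by simp)]
  have hcast : ((i + 1 : ℕ) : ℝ) - 1 = i := by push_cast; ring
  rw [hcast]
  ring

/-- Pointwise optimality: after linearization at `π`, the quantile bid is a best response. -/
lemma util_sub_Gq_le {K : ℕ} {μ : Measure ℝ} (hμ : μ (Set.Icc (0 : ℝ) 1) = 1)
    {X P : ℝ → ℝ} {π : ℕ → ℝ}
    (hX : ∀ j ≤ K, ∀ j' ≤ K, j ≤ j' → X ((j : ℝ) / K) ≤ X ((j' : ℝ) / K))
    (hπ0 : ∀ k < K + 1, 0 ≤ π k) (hπ1 : ∑ k ∈ Finset.range (K + 1), π k = 1)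
    (v : ℝ) {k : ℕ} (hk : k ≤ K) :
    X ((k : ℝ) / K) * v - P ((k : ℝ) / K) - Gq K μ X P π k ≤
      X ((bidIndex K μ π v : ℝ) / K) * v - P ((bidIndex K μ π v : ℝ) / K)
        - Gq K μ X P π (bidIndex K μ π v) := by
  refine apply_le_of_unimodal
    (D := fun k : ℕ => X ((k : ℝ) / K) * v - P ((k : ℝ) / K) - Gq K μ X P π k) (K := K) ?_ ?_ hk
  · intro i hi
    have hiK : i < K := hi.trans_le (bidIndex_le K μ π v)
    have hq := (le_bidIndex_iff hμ hπ0 hπ1 (Nat.le_add_left 1 i) hiK v).1 hi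
    have hx := hX i hiK.le (i + 1) hiK i.le_succ
    have hG := Gq_succ_sub_Gq K μ X P π hiK
    nlinarith [mul_nonneg (sub_nonneg.2 hx) (sub_nonneg.2 hq.le)]
  · intro i hi hiK
    have hq := not_lt.1 (mt (le_bidIndex_iff hμ hπ0 hπ1 (Nat.le_add_left 1 i) hiK v).2 (by omega))
    have hx := hX i hiK.le (i + 1) hiK i.le_succ
    have hG := Gq_succ_sub_Gq K μ X P π hiK
    nlinarith [mul_nonneg (sub_nonneg.2 hx) (sub_nonneg.2 hq)]

/-- The utility gap between any strategy and a quantile strategy is at most the linearized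
regret against the bid distribution of the former. -/
lemma util_sub_util_sQ_le {K : ℕ} {μ : Measure ℝ} [IsFiniteMeasure μ]
    (hμ : μ (Set.Icc (0 : ℝ) 1) = 1)
    (hFcont : ContinuousOn (cdf μ) (Set.Icc 0 1)) (hF0 : cdf μ 0 = 0)
    {X P : ℝ → ℝ} {π : ℕ → ℝ}
    (hX : ∀ j ≤ K, ∀ j' ≤ K, j ≤ j' → X ((j : ℝ) / K) ≤ X ((j' : ℝ) / K))
    (hπ0 : ∀ k < K + 1, 0 ≤ π k) (hπ1 : ∑ k ∈ Finset.range (K + 1), π k = 1)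
    {s : ℝ → ℝ} {m : ℝ → ℕ} (hm : Measurable m) (hmK : ∀ v ∈ Set.Icc (0 : ℝ) 1, m v ≤ K)
    (hs : ∀ v ∈ Set.Icc (0 : ℝ) 1, s v = (m v : ℝ) / K) :
    util μ X P s - util μ X P (sQ K μ π) ≤
      ∑ k ∈ Finset.range (K + 1),
        Gq K μ X P π k * (μ.real (m ⁻¹' {k} ∩ Set.Icc 0 1) - π k) := by
  set N := bidIndex K μ π
  have hN : Measurable N := measurable_bidIndex K μ π
  have hNK : ∀ v ∈ Set.Icc (0 : ℝ) 1, N v ≤ K := fun v _ => bidIndex_le K μ π v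
  have hutil : ∀ {n : ℝ → ℕ}, Measurable n → (∀ v ∈ Set.Icc (0 : ℝ) 1, n v ≤ K) →
      ∀ {f : ℝ → ℝ}, (∀ v ∈ Set.Icc (0 : ℝ) 1, f v = (n v : ℝ) / K) →
      IntegrableOn (fun v => X ((n v : ℝ) / K) * v - P ((n v : ℝ) / K) - Gq K μ X P π (n v))
        (Set.Icc 0 1) μ ∧
      ∫ v in Set.Icc (0 : ℝ) 1,
        (X ((n v : ℝ) / K) * v - P ((n v : ℝ) / K) - Gq K μ X P π (n v)) ∂μ =
      util μ X P f - ∑ k ∈ Finset.range (K + 1),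
        Gq K μ X P π k * μ.real (n ⁻¹' {k} ∩ Set.Icc 0 1) := by
    intro n hn hnK f hf
    have hi1 : IntegrableOn (fun v => X ((n v : ℝ) / K) * v - P ((n v : ℝ) / K))
        (Set.Icc 0 1) μ := by
      simpa only [sub_eq_add_neg] using integrableOn_affine_comp_index μ hn hnK
        (fun k => X ((k : ℝ) / K)) (fun k => -P ((k : ℝ) / K))
    have hi2 : IntegrableOn (fun v => Gq K μ X P π (n v)) (Set.Icc 0 1) μ := by
      simpa using integrableOn_affine_comp_index μ hn hnK (fun _ => 0) (Gq K μ X P π)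
    refine ⟨hi1.sub hi2, ?_⟩
    rw [integral_sub hi1 hi2, setIntegral_comp_index μ hn hnK]
    congr 1
    refine setIntegral_congr_fun measurableSet_Icc fun v hv => ?_
    simp only [hf v hv]
  obtain ⟨hi1, he1⟩ := hutil hm hmK hs
  obtain ⟨hi2, he2⟩ := hutil hN hNK (f := sQ K μ π) fun _ _ => rfl
  have hle := setIntegral_mono_on hi1 hi2 measurableSet_Icc
    fun v hv => util_sub_Gq_le (P := P) hμ hX hπ0 hπ1 v (hmK v hv)
  have hNπ : ∑ k ∈ Finset.range (K + 1), Gq K μ X P π k * μ.real (N ⁻¹' {k} ∩ Set.Icc 0 1) =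
      ∑ k ∈ Finset.range (K + 1), Gq K μ X P π k * π k :=
    Finset.sum_congr rfl fun k hk => by
      rw [measureReal_bidIndex_eq hμ hFcont hF0 hπ0 hπ1 (Finset.mem_range.1 hk)]
  rw [he1, he2, hNπ] at hle
  simp only [mul_sub, Finset.sum_sub_distrib]
  linarith

/-- **the meta-algorithm preserves no-regret.** If the linearized regret of
the played quantile strategies `π t`, with respect to the gradients `G_t` of the quantile
utility functions, is at most `R` against every point of the simplex, then the bidder's
cumulative utility from the induced quantile bidding strategies is within `R` of that of
every fixed Borel-measurable bidding strategy in hindsight. -/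
theorem meta_algorithm_no_regret
    (K T : ℕ) (hK : 1 ≤ K) (hT : 1 ≤ T)
    (μ : Measure ℝ) [IsProbabilityMeasure μ] (hμ : μ (Set.Icc (0 : ℝ) 1) = 1)
    (hFcont : ContinuousOn (cdf μ) (Set.Icc 0 1)) (hF0 : cdf μ 0 = 0)
    (X P : ℕ → ℝ → ℝ)
    (hX01 : ∀ t < T, ∀ j ≤ K, X t ((j : ℝ) / K) ∈ Set.Icc (0 : ℝ) 1)
    (hXmono : ∀ t < T, ∀ j ≤ K, ∀ j' ≤ K, j ≤ j' →
      X t ((j : ℝ) / K) ≤ X t ((j' : ℝ) / K))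
    (hP01 : ∀ t < T, ∀ j ≤ K, P t ((j : ℝ) / K) ∈ Set.Icc (0 : ℝ) 1)
    (π : ℕ → ℕ → ℝ)
    (hπ0 : ∀ t < T, ∀ k < K + 1, 0 ≤ π t k)
    (hπ1 : ∀ t < T, ∑ k ∈ Finset.range (K + 1), π t k = 1)
    (R : ℝ)
    (hlinreg : ∀ ρ : ℕ → ℝ, (∀ k < K + 1, 0 ≤ ρ k) →
      (∑ k ∈ Finset.range (K + 1), ρ k = 1) →
      ∑ t ∈ Finset.range T, ∑ k ∈ Finset.range (K + 1),
        Gq K μ (X t) (P t) (π t) k * (ρ k - π t k) ≤ R) :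
    ∀ s : ℝ → ℝ, Measurable s → (∀ v ∈ Set.Icc (0 : ℝ) 1, s v ∈ BidSet K) →
      ∑ t ∈ Finset.range T,
        (util μ (X t) (P t) s - util μ (X t) (P t) (sQ K μ (π t))) ≤ R := by
  intro s hs hsB
  have hK0 : (K : ℝ) ≠ 0 := Nat.cast_ne_zero.2 (by omega)
  have hm : Measurable fun v => ⌊(K : ℝ) * s v⌋₊ := (hs.const_mul (K : ℝ)).nat_floor
  have hmB : ∀ v ∈ Set.Icc (0 : ℝ) 1,
      ⌊(K : ℝ) * s v⌋₊ ≤ K ∧ s v = ((⌊(K : ℝ) * s v⌋₊ : ℕ) : ℝ) / K := by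
    intro v hv
    obtain ⟨j, hj, hsj⟩ := hsB v hv
    have : (K : ℝ) * s v = j := by rw [hsj]; field_simp
    rw [this, Nat.floor_natCast]
    exact ⟨hj, hsj⟩
  refine (Finset.sum_le_sum fun t ht => ?_).trans
    (hlinreg (fun k => μ.real ((fun v => ⌊(K : ℝ) * s v⌋₊) ⁻¹' {k} ∩ Set.Icc 0 1))
      (fun _ _ => measureReal_nonneg) ?_)
  · have ht := Finset.mem_range.1 ht
    exact util_sub_util_sQ_le hμ hFcont hF0 (hXmono t ht) (hπ0 t ht) (hπ1 t ht) hm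
      (fun v hv => (hmB v hv).1) (fun v hv => (hmB v hv).2)
  · have h := setIntegral_comp_index μ hm (fun v hv => (hmB v hv).1) fun _ => 1
    simpa [Measure.real, hμ] using h.symm
end
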